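/- arXiv:2410.15727 — 2 statements merged into one kernel-verified Lean document; each statement's English description precedes it below -/
import Mathlib

section
/- There exists a constant C > 0 such that for every t ≥ 2 and every R > 0, ( (1/|B(0,R)|) ∫_{B(0,R)} min(t, φ(x)) dx ) · ( (1/|B(0,R)|) ∫_{B(0,R)} min(t, φ(x))^{-1} dx ) ≤ C. -/
open MeasureTheory Real Filter
open scoped ENNReal RealInnerProductSpace

noncomputable def φ (x : EuclideanSpace ℝ (Fin 2)) : ℝ := Real.sqrt (‖x‖ ^ 2 + 1)

noncomputable def ψ (t : ℝ) (x : EuclideanSpace ℝ (Fin 2)) : ℝ :=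
  φ x * (1 - Real.exp (-t / φ x))

theorem volume_real_ball_fin_two {r : ℝ} (hr : 0 ≤ r) :
    volume.real (Metric.ball (0 : EuclideanSpace ℝ (Fin 2)) r) = π * r ^ 2 := by
  rw [measureReal_def, EuclideanSpace.volume_ball_fin_two, ENNReal.toReal_mul,
    ENNReal.toReal_pow, ENNReal.toReal_ofReal hr]
  simp [mul_comm, pi_nonneg]

theorem integrableOn_inv_norm_ball_and_setIntegral {R : ℝ} (hR : 0 < R) :
    IntegrableOn (fun x : EuclideanSpace ℝ (Fin 2) ↦ ‖x‖⁻¹) (Metric.ball 0 R) ∧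
      ∫ x in Metric.ball (0 : EuclideanSpace ℝ (Fin 2)) R, ‖x‖⁻¹ = 2 * π * R := by
  have h_ball : (Metric.ball (0 : EuclideanSpace ℝ (Fin 2)) R).indicator (fun x ↦ ‖x‖⁻¹) =
      fun x ↦ (Set.Iio R).indicator (fun y : ℝ ↦ y⁻¹) ‖x‖ := by
    ext x
    simp [Set.indicator]
  have h_radial : Set.EqOn (fun y : ℝ ↦ y ^ (2 - 1) • (Set.Iio R).indicator (fun y : ℝ ↦ y⁻¹) y)
      ((Set.Iio R).indicator fun _ ↦ 1) (Set.Ioi 0) := by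
    intro y hy
    have hy' : y ≠ 0 := ne_of_gt hy
    by_cases h : y < R <;> simp [Set.indicator, h, hy']
  have h_inter : Set.Iio R ∩ Set.Ioi 0 = Set.Ioo 0 R := by
    rw [Set.inter_comm, Set.Ioi_inter_Iio]
  constructor
  · rw [← integrable_indicator_iff measurableSet_ball, h_ball,
      integrable_fun_norm_addHaar, finrank_euclideanSpace_fin,
      integrableOn_congr_fun h_radial measurableSet_Ioi, IntegrableOn,
      integrable_indicator_iff measurableSet_Iio, IntegrableOn,
      Measure.restrict_restrict measurableSet_Iio, h_inter]
    exact integrable_const _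
  · rw [← integral_indicator measurableSet_ball, h_ball, integral_fun_norm_addHaar,
      finrank_euclideanSpace_fin, setIntegral_congr_fun measurableSet_Ioi h_radial,
      integral_indicator measurableSet_Iio, Measure.restrict_restrict measurableSet_Iio, h_inter,
      volume_real_ball_fin_two zero_le_one]
    simp [hR.le]
    ring

theorem phi_pos (x : EuclideanSpace ℝ (Fin 2)) : 0 < φ x := Real.sqrt_pos.2 (by positivity)

theorem norm_div_mul_le_min {t R : ℝ} (ht : 0 ≤ t) (hR : 0 < R)
    {x : EuclideanSpace ℝ (Fin 2)} (hx : ‖x‖ ≤ R) :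
    ‖x‖ / R * min t (√(R ^ 2 + 1)) ≤ min t (φ x) := by
  have h1 : ‖x‖ / R ≤ 1 := (div_le_one hR).2 hx
  have h0 : 0 ≤ ‖x‖ / R := by positivity
  refine le_min ?_ ?_
  · calc ‖x‖ / R * min t (√(R ^ 2 + 1)) ≤ 1 * t := by gcongr; exact min_le_left _ _
      _ = t := one_mul t
  · calc ‖x‖ / R * min t (√(R ^ 2 + 1)) ≤ ‖x‖ / R * √(R ^ 2 + 1) := by
          gcongr; exact min_le_right _ _
      _ ≤ φ x := by
        refine Real.le_sqrt_of_sq_le ?_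
        rw [mul_pow, Real.sq_sqrt (by positivity)]
        have h2 : (‖x‖ / R) ^ 2 ≤ 1 := pow_le_one₀ h0 h1
        have h3 : (‖x‖ / R) ^ 2 * R ^ 2 = ‖x‖ ^ 2 := by field_simp
        linarith

theorem min_phi_le {t R : ℝ} {x : EuclideanSpace ℝ (Fin 2)} (hx : ‖x‖ ≤ R) :
    min t (φ x) ≤ min t (√(R ^ 2 + 1)) := by
  unfold φ
  gcongr

/-- There is `C > 0` such that for every `t ≥ 2` and every `R > 0`, the `A₂`-product
of averages of `min(t, φ)` over the centered ball `B(0,R)` is at most `C`. -/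
theorem a2_product_centered_balls_bounded :
    ∃ C > 0, ∀ t : ℝ, 2 ≤ t → ∀ R : ℝ, 0 < R →
      ((Real.pi * R ^ 2)⁻¹ * ∫ x in Metric.ball (0 : EuclideanSpace ℝ (Fin 2)) R, min t (φ x)) *
        ((Real.pi * R ^ 2)⁻¹ *
          ∫ x in Metric.ball (0 : EuclideanSpace ℝ (Fin 2)) R, (min t (φ x))⁻¹) ≤ C := by
  refine ⟨2, two_pos, fun t ht R hR ↦ ?_⟩
  have ht0 : 0 < t := by linarith
  have hw (x) : 0 < min t (φ x) := lt_min ht0 (phi_pos x)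
  set M := min t (√(R ^ 2 + 1))
  have hM0 : 0 < M := lt_min ht0 (by positivity)
  have h_upper : ∫ x in Metric.ball (0 : EuclideanSpace ℝ (Fin 2)) R, min t (φ x) ≤
      π * R ^ 2 * M := by
    calc _ ≤ ∫ x in Metric.ball (0 : EuclideanSpace ℝ (Fin 2)) R, M := by
          refine integral_mono_of_nonneg (ae_of_all _ fun x ↦ (hw x).le)
            (integrableOn_const measure_ball_lt_top.ne) ?_
          filter_upwards [ae_restrict_mem measurableSet_ball] with x hx
          exact min_phi_le (mem_ball_zero_iff.1 hx).le
      _ = _ := by rw [setIntegral_const, volume_real_ball_fin_two hR.le, smul_eq_mul]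
  have h_inv : ∫ x in Metric.ball (0 : EuclideanSpace ℝ (Fin 2)) R, (min t (φ x))⁻¹ ≤
      R / M * (2 * π * R) := by
    obtain ⟨h_int, h_eq⟩ := integrableOn_inv_norm_ball_and_setIntegral hR
    rw [← h_eq, ← integral_const_mul]
    refine integral_mono_of_nonneg (ae_of_all _ fun x ↦ (inv_pos.2 (hw x)).le)
      (h_int.const_mul _) ?_
    filter_upwards [ae_restrict_mem measurableSet_ball,
      ae_restrict_of_ae (Measure.ae_ne volume 0)] with x hx hx0
    have hx1 : 0 < ‖x‖ := norm_pos_iff.2 hx0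
    calc (min t (φ x))⁻¹ ≤ (‖x‖ / R * M)⁻¹ :=
          inv_anti₀ (by positivity) (norm_div_mul_le_min ht0.le hR (mem_ball_zero_iff.1 hx).le)
      _ = R / M * ‖x‖⁻¹ := by field_simp
  have h_nonneg : 0 ≤ ∫ x in Metric.ball (0 : EuclideanSpace ℝ (Fin 2)) R, (min t (φ x))⁻¹ :=
    integral_nonneg fun x ↦ (inv_pos.2 (hw x)).le
  calc _ ≤ ((π * R ^ 2)⁻¹ * (π * R ^ 2 * M)) * ((π * R ^ 2)⁻¹ * (R / M * (2 * π * R))) := by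
        gcongr
    _ = 2 := by field_simp
end

section
/- For every δ > 0 there exists a constant C = C(δ) > 0 such that for every t ≥ 0 and every smooth compactly supported vector field u : ℝ² → ℝ² with div u = 0, one has | ∫_{ℝ²} ψ(t,x)² u(x)·((u·∇)u)(x) dx | ≤ δ ∫_{ℝ²} ψ(t,x)²|u|² dx + δ ∫_{ℝ²} ψ(t,x)²|∇u|² dx + C ∫_{ℝ²} |∇u|² dx + C ( 1 + ( ∫_{ℝ²} |u|² dx )³ ). -/
open MeasureTheory Real Filter
open scoped ENNReal

/-- The partial derivative `∂ᵢ f` of a scalar function on `ℝ²`. -/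
noncomputable def pd (i : Fin 2) (f : EuclideanSpace ℝ (Fin 2) → ℝ)
    (x : EuclideanSpace ℝ (Fin 2)) : ℝ :=
  fderiv ℝ f x (EuclideanSpace.single i 1)

/-- The plane `ℝ²` with its Euclidean norm. -/
local notation "ℝ²" => EuclideanSpace ℝ (Fin 2)

theorem one_le_φ (x : ℝ²) : 1 ≤ φ x := by
  unfold φ
  rw [Real.one_le_sqrt]
  nlinarith [sq_nonneg ‖x‖]

theorem φ_pos (x : ℝ²) : 0 < φ x := one_pos.trans_le (one_le_φ x)

theorem contDiff_φ {n : WithTop ℕ∞} : ContDiff ℝ n φ :=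
  ((contDiff_norm_sq ℝ).add contDiff_const).sqrt fun x => by positivity

theorem contDiff_ψ {n : WithTop ℕ∞} (t : ℝ) : ContDiff ℝ n (ψ t) :=
  contDiff_φ.mul (contDiff_const.sub
    (contDiff_const.div contDiff_φ fun x => (φ_pos x).ne').exp)

theorem norm_fderiv_φ_le (x : ℝ²) : ‖fderiv ℝ φ x‖ ≤ 1 := by
  have h : HasFDerivAt φ ((1 / (2 * φ x)) • (2 • innerSL ℝ x)) x := by
    have h1 : HasFDerivAt (fun y : ℝ² => ‖y‖ ^ 2 + 1) (2 • innerSL ℝ x) x :=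
      (hasStrictFDerivAt_norm_sq x).hasFDerivAt.add_const 1
    exact h1.sqrt (by positivity)
  have hx : ‖x‖ ≤ φ x := Real.le_sqrt_of_sq_le (by linarith)
  have hp := φ_pos x
  rw [h.fderiv]
  refine ContinuousLinearMap.opNorm_le_bound _ zero_le_one fun v => ?_
  have hv := abs_real_inner_le_norm x v
  have : ((1 / (2 * φ x)) • (2 • innerSL ℝ x)) v = inner ℝ x v / φ x := by
    simp
    field_simp
  rw [this, Real.norm_eq_abs, abs_div, abs_of_pos hp, div_le_iff₀ hp]
  nlinarith [norm_nonneg v]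

theorem ψ_nonneg {t : ℝ} (ht : 0 ≤ t) (x : ℝ²) : 0 ≤ ψ t x := by
  have : exp (-t / φ x) ≤ 1 :=
    Real.exp_le_one_iff.2 (div_nonpos_of_nonpos_of_nonneg (by linarith) (φ_pos x).le)
  exact mul_nonneg (φ_pos x).le (by linarith)

theorem norm_fderiv_ψ_le_one_sub_exp {t : ℝ} (ht : 0 ≤ t) (x : ℝ²) :
    ‖fderiv ℝ (ψ t) x‖ ≤ 1 - exp (-t / φ x) := by
  have hp := φ_pos x
  have hφ : HasFDerivAt φ (fderiv ℝ φ x) x :=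
    (contDiff_φ.differentiable one_ne_zero x).hasFDerivAt
  have hscalar : HasDerivAt (fun r : ℝ => r * (1 - exp (-t / r)))
      (1 - exp (-t / φ x) - t / φ x * exp (-t / φ x)) (φ x) := by
    have h1 : HasDerivAt (fun r : ℝ => -t / r) (t / φ x ^ 2) (φ x) := by
      simpa [div_eq_mul_inv] using (hasDerivAt_inv hp.ne').const_mul (-t)
    refine ((hasDerivAt_id (φ x)).mul (h1.exp.const_sub 1)).congr_deriv ?_
    simp only [id]
    field_simp
    ring
  have h : HasFDerivAt (ψ t) _ x := hscalar.comp_hasFDerivAt x hφ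
  set s := t / φ x with hs
  have hs0 : 0 ≤ s := div_nonneg ht hp.le
  have hns : -t / φ x = -s := neg_div _ _
  rw [h.fderiv, norm_smul, hns]
  have he := exp_pos (-s)
  have hle : (1 + s) * exp (-s) ≤ 1 := by
    have := mul_le_mul_of_nonneg_right (add_one_le_exp s) he.le
    rw [← exp_add, add_neg_cancel, exp_zero] at this
    linarith
  have hse : 0 ≤ s * exp (-s) := by positivity
  rw [Real.norm_eq_abs, abs_of_nonneg (by linarith)]
  nlinarith [norm_fderiv_φ_le x, norm_nonneg (fderiv ℝ φ x)]

theorem norm_fderiv_ψ_le_one {t : ℝ} (ht : 0 ≤ t) (x : ℝ²) : ‖fderiv ℝ (ψ t) x‖ ≤ 1 :=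
  (norm_fderiv_ψ_le_one_sub_exp ht x).trans (by linarith [exp_pos (-t / φ x)])

theorem norm_fderiv_ψ_le_self {t : ℝ} (ht : 0 ≤ t) (x : ℝ²) : ‖fderiv ℝ (ψ t) x‖ ≤ ψ t x := by
  have h := norm_fderiv_ψ_le_one_sub_exp ht x
  have h0 := (norm_nonneg _).trans h
  unfold ψ at h ⊢
  nlinarith [one_le_φ x]

theorem integral_fderiv_apply_eq_zero {E : Type*} [NormedAddCommGroup E] [NormedSpace ℝ E]
    [MeasurableSpace E] [BorelSpace E] [FiniteDimensional ℝ E] {μ : Measure E} [μ.IsAddHaarMeasure]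
    {f : E → ℝ} (hf : ContDiff ℝ 1 f)
    (hc : HasCompactSupport f) (v : E) : ∫ x, fderiv ℝ f x v ∂μ = 0 := by
  have hi : Integrable (fun x => fderiv ℝ f x v) μ :=
    ((hf.continuous_fderiv one_ne_zero).clm_apply
      continuous_const).integrable_of_hasCompactSupport (hc.fderiv_apply (𝕜 := ℝ) v)
  have h := integral_mul_fderiv_eq_neg_fderiv_mul_of_integrable (μ := μ) (f := fun _ : E => (1 : ℝ))
    (g := f) (v := v) (by simp) (by simpa using hi)
    (by simpa using hf.continuous.integrable_of_hasCompactSupport hc)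
    (fun x _ => differentiableAt_const _) (fun x _ => hf.differentiable one_ne_zero x)
  simpa using h

theorem pd_eq_fderiv_apply {u : ℝ² → ℝ²} {x : ℝ²} (hu : DifferentiableAt ℝ u x) (i j : Fin 2) :
    pd i (fun y => u y j) x = fderiv ℝ u x (EuclideanSpace.single i 1) j := by
  have h : HasFDerivAt (fun y => u y j)
      ((EuclideanSpace.proj j : ℝ² →L[ℝ] ℝ).comp (fderiv ℝ u x)) x :=
    (EuclideanSpace.proj j : ℝ² →L[ℝ] ℝ).hasFDerivAt.comp x hu.hasFDerivAt
  simp [pd, h.fderiv]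

theorem eq_sum_smul_single (v : ℝ²) :
    v = v 0 • EuclideanSpace.single 0 (1 : ℝ) + v 1 • EuclideanSpace.single 1 (1 : ℝ) := by
  ext i
  fin_cases i <;> simp

theorem fderiv_apply_coord {u : ℝ² → ℝ²} {x : ℝ²} (hu : DifferentiableAt ℝ u x) (v : ℝ²)
    (j : Fin 2) : fderiv ℝ u x v j =
      v 0 * pd 0 (fun y => u y j) x + v 1 * pd 1 (fun y => u y j) x := by
  conv_lhs => rw [eq_sum_smul_single v]
  simp [pd_eq_fderiv_apply hu]

theorem integral_fderiv_apply_divergence_free {w : ℝ² → ℝ} {u : ℝ² → ℝ²} (hw : ContDiff ℝ 1 w)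
    (hu : ContDiff ℝ 1 u) (hc : HasCompactSupport u)
    (hdiv : ∀ x, pd 0 (fun y => u y 0) x + pd 1 (fun y => u y 1) x = 0) :
    ∫ x, fderiv ℝ w x (u x) = 0 := by
  have hcoord (k : Fin 2) : ContDiff ℝ 1 (fun y => u y k) := contDiff_euclidean.1 hu k
  have hprod (k : Fin 2) : ContDiff ℝ 1 (fun y => w y * u y k) := hw.mul (hcoord k)
  have hck (k : Fin 2) : HasCompactSupport (fun y => w y * u y k) :=
    (hc.comp_left (g := fun v : ℝ² => v k) rfl).mul_left
  have hi (k : Fin 2) : Integrable (fun x => pd k (fun y => w y * u y k) x) :=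
    (((hprod k).continuous_fderiv one_ne_zero).clm_apply
      continuous_const).integrable_of_hasCompactSupport ((hck k).fderiv_apply (𝕜 := ℝ) _)
  have hz (k : Fin 2) : ∫ x, pd k (fun y => w y * u y k) x = 0 :=
    integral_fderiv_apply_eq_zero (hprod k) (hck k) _
  have hpt (x : ℝ²) : fderiv ℝ w x (u x) =
      pd 0 (fun y => w y * u y 0) x + pd 1 (fun y => w y * u y 1) x := by
    have hk (k : Fin 2) : pd k (fun y => w y * u y k) x =
        w x * pd k (fun y => u y k) x + u x k * fderiv ℝ w x (EuclideanSpace.single k 1) := by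
      have := (hw.differentiable one_ne_zero x).hasFDerivAt.mul
        ((hcoord k).differentiable one_ne_zero x).hasFDerivAt
      rw [pd, HasFDerivAt.fderiv (f := fun y => w y * u y k) this]
      simp [pd]
    conv_lhs => rw [eq_sum_smul_single (u x)]
    rw [hk, hk, map_add, map_smul, map_smul, smul_eq_mul, smul_eq_mul]
    linear_combination -w x * hdiv x
  simp_rw [hpt]
  rw [integral_add (hi 0) (hi 1), hz, hz, add_zero]

theorem norm_fderiv_le_sqrt_sum_sq {u : ℝ² → ℝ²} {x : ℝ²} (hu : DifferentiableAt ℝ u x) :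
    ‖fderiv ℝ u x‖ ≤ √(∑ i : Fin 2, ∑ j : Fin 2, pd i (fun y => u y j) x ^ 2) := by
  refine ContinuousLinearMap.opNorm_le_bound _ (Real.sqrt_nonneg _) fun v => ?_
  rw [EuclideanSpace.norm_eq, EuclideanSpace.norm_eq, ← Real.sqrt_mul (by positivity)]
  refine Real.sqrt_le_sqrt ?_
  simp only [Fin.sum_univ_two, Real.norm_eq_abs, sq_abs, fderiv_apply_coord hu]
  nlinarith [sq_nonneg (v 0 * pd 1 (fun y => u y 0) x - v 1 * pd 0 (fun y => u y 0) x),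
    sq_nonneg (v 0 * pd 1 (fun y => u y 1) x - v 1 * pd 0 (fun y => u y 1) x)]

/-- The Gagliardo–Nirenberg–Sobolev inequality `‖f‖₂ ≤ K ‖∇f‖₁` in two dimensions. -/
theorem exists_sqrt_integral_sq_le_integral_norm_fderiv {E : Type*} [NormedAddCommGroup E]
    [NormedSpace ℝ E] [MeasurableSpace E] [BorelSpace E] [FiniteDimensional ℝ E]
    (hE : Module.finrank ℝ E = 2) (μ : Measure E) [μ.IsAddHaarMeasure] :
    ∃ K : ℝ, 0 ≤ K ∧ ∀ f : E → ℝ, ContDiff ℝ 1 f → HasCompactSupport f →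
      √(∫ x, f x ^ 2 ∂μ) ≤ K * ∫ x, ‖fderiv ℝ f x‖ ∂μ := by
  obtain ⟨K, hK⟩ : ∃ K : NNReal, ∀ f : E → ℝ, ContDiff ℝ 1 f → HasCompactSupport f →
      ∫⁻ x, ‖f x‖ₑ ^ (2 : ℝ) ∂μ ≤ K * (∫⁻ x, ‖fderiv ℝ f x‖ₑ ∂μ) ^ (2 : ℝ) :=
    ⟨_, fun f hf hc => lintegral_pow_le_pow_lintegral_fderiv μ hf hc
      (by simpa [hE] using Real.HolderConjugate.two_two)⟩
  refine ⟨√K, Real.sqrt_nonneg _, fun f hf hc => ?_⟩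
  have h := hK f hf hc
  have hi1 : Integrable (fun x => f x ^ 2) μ := by
    simp_rw [sq]
    exact (hf.continuous.mul hf.continuous).integrable_of_hasCompactSupport hc.mul_left
  have hi2 : Integrable (fderiv ℝ f) μ :=
    (hf.continuous_fderiv one_ne_zero).integrable_of_hasCompactSupport (hc.fderiv (𝕜 := ℝ))
  have he (x : E) : ‖f x‖ₑ ^ (2 : ℝ) = ENNReal.ofReal (f x ^ 2) := by
    rw [ENNReal.rpow_ofNat, ← ofReal_norm, ← ENNReal.ofReal_pow (norm_nonneg _),
      Real.norm_eq_abs, sq_abs]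
  simp_rw [he] at h
  rw [← ofReal_integral_eq_lintegral_ofReal hi1 (ae_of_all _ fun x => sq_nonneg _),
    ← ofReal_integral_norm_eq_lintegral_enorm hi2, ENNReal.rpow_ofNat,
    ← ENNReal.ofReal_pow (by positivity), ← ENNReal.ofReal_coe_nnreal,
    ← ENNReal.ofReal_mul (by positivity), ENNReal.ofReal_le_ofReal_iff (by positivity)] at h
  refine (Real.sqrt_le_sqrt h).trans_eq ?_
  rw [Real.sqrt_mul (by positivity), Real.sqrt_sq (by positivity)]

theorem integral_mul_le_sqrt_mul_sqrt {α : Type*} [MeasurableSpace α] {μ : Measure α}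
    {f g : α → ℝ} (hf : 0 ≤ f) (hg : 0 ≤ g) (hf2 : MemLp f 2 μ) (hg2 : MemLp g 2 μ) :
    ∫ x, f x * g x ∂μ ≤ √(∫ x, f x ^ 2 ∂μ) * √(∫ x, g x ^ 2 ∂μ) := by
  have h := integral_mul_le_Lp_mul_Lq_of_nonneg (μ := μ) Real.HolderConjugate.two_two
    (ae_of_all _ hf) (ae_of_all _ hg) (by simpa using hf2) (by simpa using hg2)
  simpa [Real.sqrt_eq_rpow] using h

theorem norm_fderiv_ψ_mul_norm_sq_le {t : ℝ} (ht : 0 ≤ t) {u : ℝ² → ℝ²} {x : ℝ²}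
    (hu : DifferentiableAt ℝ u x) :
    ‖fderiv ℝ (fun y => ψ t y * ‖u y‖ ^ 2) x‖ ≤ ψ t x * ‖u x‖ ^ 2 + 2 * (ψ t x * ‖u x‖ *
      √(∑ i : Fin 2, ∑ j : Fin 2, pd i (fun y => u y j) x ^ 2)) := by
  have hψ := ((contDiff_ψ t).differentiable one_ne_zero x).hasFDerivAt
  have h : HasFDerivAt (fun y => ψ t y * ‖u y‖ ^ 2) _ x := hψ.mul hu.hasFDerivAt.norm_sq
  rw [h.fderiv]
  have h0 := ψ_nonneg ht x
  have hb := norm_fderiv_le_sqrt_sum_sq hu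
  set b := √(∑ i : Fin 2, ∑ j : Fin 2, pd i (fun y => u y j) x ^ 2)
  have h1 : ‖(innerSL ℝ (u x)).comp (fderiv ℝ u x)‖ ≤ ‖u x‖ * b :=
    (ContinuousLinearMap.opNorm_comp_le _ _).trans (by rw [innerSL_apply_norm]; gcongr)
  refine (norm_add_le _ _).trans ?_
  rw [← Nat.cast_smul_eq_nsmul ℝ, norm_smul, norm_smul, norm_smul]
  simp only [Real.norm_eq_abs, abs_of_nonneg h0, abs_of_nonneg (sq_nonneg ‖u x‖), Nat.cast_ofNat,
    Nat.abs_ofNat]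
  have h2 := mul_le_mul_of_nonneg_left h1 h0
  have h3 := mul_le_mul_of_nonneg_left (norm_fderiv_ψ_le_self ht x) (sq_nonneg ‖u x‖)
  linarith

theorem abs_integral_ψ_sq_convection_le {t : ℝ} (ht : 0 ≤ t) {u : ℝ² → ℝ²}
    (hu : ContDiff ℝ 1 u) (hc : HasCompactSupport u)
    (hdiv : ∀ x, pd 0 (fun y => u y 0) x + pd 1 (fun y => u y 1) x = 0) :
    |∫ x, ψ t x ^ 2 * ∑ j : Fin 2, u x j * ∑ k : Fin 2, u x k * pd k (fun y => u y j) x| ≤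
      ∫ x, ‖u x‖ * (ψ t x * ‖u x‖ ^ 2) := by
  have hψ : ContDiff ℝ 1 (ψ t) := contDiff_ψ t
  have hw : ContDiff ℝ 1 (fun y => ψ t y ^ 2 * ‖u y‖ ^ 2) := (hψ.pow 2).mul (hu.norm_sq ℝ)
  have hpt (x : ℝ²) :
      ψ t x ^ 2 * ∑ j : Fin 2, u x j * ∑ k : Fin 2, u x k * pd k (fun y => u y j) x =
      1 / 2 * fderiv ℝ (fun y => ψ t y ^ 2 * ‖u y‖ ^ 2) x (u x) -
        ψ t x * ‖u x‖ ^ 2 * fderiv ℝ (ψ t) x (u x) := by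
    have hux := hu.differentiable one_ne_zero x
    have h : HasFDerivAt (fun y => ψ t y ^ 2 * ‖u y‖ ^ 2) _ x :=
      ((hψ.differentiable one_ne_zero x).hasFDerivAt.pow 2).mul hux.hasFDerivAt.norm_sq
    rw [h.fderiv]
    have hin : inner ℝ (u x) (fderiv ℝ u x (u x)) =
        ∑ j : Fin 2, u x j * ∑ k : Fin 2, u x k * pd k (fun y => u y j) x := by
      simp [PiLp.inner_apply, Fin.sum_univ_two, fderiv_apply_coord hux]
      ring
    rw [← hin]
    simp
    ring
  have hci : HasCompactSupport (fun x => ψ t x * ‖u x‖ ^ 2 * fderiv ℝ (ψ t) x (u x)) :=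
    ((hc.comp_left (g := fun v : ℝ² => ‖v‖ ^ 2) (by simp)).mul_left).mul_right
  have hi2 : Integrable (fun x => ψ t x * ‖u x‖ ^ 2 * fderiv ℝ (ψ t) x (u x)) :=
    ((hψ.continuous.mul (hu.continuous.norm.pow 2)).mul
      ((hψ.continuous_fderiv one_ne_zero).clm_apply
        hu.continuous)).integrable_of_hasCompactSupport hci
  have hi1 : Integrable (fun x => fderiv ℝ (fun y => ψ t y ^ 2 * ‖u y‖ ^ 2) x (u x)) :=
    ((hw.continuous_fderiv one_ne_zero).clm_apply
        hu.continuous).integrable_of_hasCompactSupport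
      (hc.mono fun x hx => by
        contrapose! hx
        simp only [Function.mem_support, not_not] at hx ⊢
        rw [hx, map_zero])
  have hi3 : Integrable (fun x => ‖u x‖ * (ψ t x * ‖u x‖ ^ 2)) :=
    (hu.continuous.norm.mul
      (hψ.continuous.mul (hu.continuous.norm.pow 2))).integrable_of_hasCompactSupport
      hc.norm.mul_right
  simp_rw [hpt]
  rw [integral_sub (hi1.const_mul _) hi2, integral_const_mul,
    integral_fderiv_apply_divergence_free hw hu hc hdiv, mul_zero, zero_sub, abs_neg]
  refine abs_integral_le_integral_abs.trans (integral_mono hi2.abs hi3 fun x => ?_)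
  have h0 := ψ_nonneg ht x
  have hd : |fderiv ℝ (ψ t) x (u x)| ≤ ‖u x‖ :=
    (ContinuousLinearMap.le_of_opNorm_le _ (norm_fderiv_ψ_le_one ht x) _).trans_eq (one_mul _)
  simp only [abs_mul, abs_of_nonneg h0, abs_of_nonneg (sq_nonneg ‖u x‖)]
  rw [mul_comm ‖u x‖]
  gcongr

theorem weighted_young_le {δ : ℝ} (hδ : 0 < δ) {p : ℝ} (hp : 0 ≤ p) (c a b : ℝ) :
    c * (p * a ^ 2 + 2 * (p * a * b)) ≤ δ * (p ^ 2 * a ^ 2) + δ * (p ^ 2 * b ^ 2) +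
      1 / (4 * δ) * b ^ 2 + (c ^ 2 + c ^ 4) / (2 * δ) * a ^ 2 := by
  have h1 : c * p * a ^ 2 ≤ δ / 2 * (p ^ 2 * a ^ 2) + c ^ 2 / (2 * δ) * a ^ 2 := by
    have : 0 ≤ (δ * p - c) ^ 2 * a ^ 2 / (2 * δ) := by positivity
    have e : (δ * p - c) ^ 2 * a ^ 2 / (2 * δ) =
      δ / 2 * (p ^ 2 * a ^ 2) + c ^ 2 / (2 * δ) * a ^ 2 - c * p * a ^ 2 := by field_simp; ring
    linarith
  have h2 : p * (c * a) ^ 2 ≤ δ / 2 * (p ^ 2 * a ^ 2) + c ^ 4 / (2 * δ) * a ^ 2 := by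
    have : 0 ≤ (δ * p - c ^ 2) ^ 2 * a ^ 2 / (2 * δ) := by positivity
    have e : (δ * p - c ^ 2) ^ 2 * a ^ 2 / (2 * δ) =
      δ / 2 * (p ^ 2 * a ^ 2) + c ^ 4 / (2 * δ) * a ^ 2 - p * (c * a) ^ 2 := by field_simp; ring
    linarith
  have h3 : p * b ^ 2 ≤ δ * (p ^ 2 * b ^ 2) + 1 / (4 * δ) * b ^ 2 := by
    have : 0 ≤ (2 * δ * p - 1) ^ 2 * b ^ 2 / (4 * δ) := by positivity
    have e : (2 * δ * p - 1) ^ 2 * b ^ 2 / (4 * δ) =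
      δ * (p ^ 2 * b ^ 2) + 1 / (4 * δ) * b ^ 2 - p * b ^ 2 := by field_simp; ring
    linarith
  have h4 : 0 ≤ p * (c * a - b) ^ 2 := by positivity
  have e : (c ^ 2 + c ^ 4) / (2 * δ) * a ^ 2 =
    c ^ 2 / (2 * δ) * a ^ 2 + c ^ 4 / (2 * δ) * a ^ 2 := by ring
  linarith

/-- Estimate for the weighted convection term: for every `δ > 0` there is `C > 0` such
that for all `t ≥ 0` and all smooth compactly supported divergence-free `u : ℝ² → ℝ²`,
`|∫ ψ² u·((u·∇)u)| ≤ δ∫ψ²|u|² + δ∫ψ²|∇u|² + C∫|∇u|² + C(1 + (∫|u|²)³)`. -/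
theorem weighted_convection_estimate (δ : ℝ) (hδ : 0 < δ) :
    ∃ C > 0, ∀ t : ℝ, 0 ≤ t →
      ∀ u : EuclideanSpace ℝ (Fin 2) → EuclideanSpace ℝ (Fin 2),
        ContDiff ℝ (⊤ : ℕ∞) u → HasCompactSupport u →
        (∀ x, pd 0 (fun y => u y 0) x + pd 1 (fun y => u y 1) x = 0) →
        |∫ x, ψ t x ^ 2 * ∑ j : Fin 2, u x j *
            ∑ k : Fin 2, u x k * pd k (fun y => u y j) x| ≤
          δ * (∫ x, ψ t x ^ 2 * ‖u x‖ ^ 2) +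
          δ * (∫ x, ψ t x ^ 2 * ∑ i : Fin 2, ∑ j : Fin 2, pd i (fun y => u y j) x ^ 2) +
          C * (∫ x, ∑ i : Fin 2, ∑ j : Fin 2, pd i (fun y => u y j) x ^ 2) +
          C * (1 + (∫ x, ‖u x‖ ^ 2) ^ 3) := by
  obtain ⟨K, hK, hGNS⟩ := exists_sqrt_integral_sq_le_integral_norm_fderiv
    (E := ℝ²) (by simp) volume
  refine ⟨1 / (4 * δ) + (K ^ 2 + K ^ 4) / (2 * δ), by positivity, fun t ht u hu hc hdiv => ?_⟩
  have hu1 : ContDiff ℝ 1 u := hu.of_le (by exact_mod_cast le_top)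
  have hψ : ContDiff ℝ 1 (ψ t) := contDiff_ψ t
  set B : ℝ² → ℝ := fun x => ∑ i : Fin 2, ∑ j : Fin 2, pd i (fun y => u y j) x ^ 2 with hB
  have hB0 (x : ℝ²) : 0 ≤ B x := by positivity
  have hcoord (j : Fin 2) : ContDiff ℝ 1 (fun y => u y j) := contDiff_euclidean.1 hu1 j
  have hBcont : Continuous B := by
    refine continuous_finsetSum _ fun i _ => continuous_finsetSum _ fun j _ => Continuous.pow ?_ 2
    exact ((hcoord j).continuous_fderiv one_ne_zero).clm_apply continuous_const
  have hBc : HasCompactSupport B := by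
    refine (hc.fderiv (𝕜 := ℝ)).mono fun x hx => ?_
    contrapose! hx
    simp only [Function.mem_support, not_not] at hx ⊢
    simp [hB, pd_eq_fderiv_apply (hu1.differentiable one_ne_zero x), hx]
  have ha2c : HasCompactSupport (fun x => ‖u x‖ ^ 2) :=
    hc.comp_left (g := fun v : ℝ² => ‖v‖ ^ 2) (by simp)
  have hf : ContDiff ℝ 1 (fun x => ψ t x * ‖u x‖ ^ 2) := hψ.mul (hu1.norm_sq ℝ)
  have hfc : HasCompactSupport (fun x => ψ t x * ‖u x‖ ^ 2) := ha2c.mul_left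
  have hIa : Integrable (fun x => ‖u x‖ ^ 2) :=
    (hu1.norm_sq ℝ).continuous.integrable_of_hasCompactSupport ha2c
  have hIB : Integrable B := hBcont.integrable_of_hasCompactSupport hBc
  have hIψa : Integrable (fun x => ψ t x ^ 2 * ‖u x‖ ^ 2) :=
    ((hψ.continuous.pow 2).mul (hu1.norm_sq ℝ).continuous).integrable_of_hasCompactSupport
      ha2c.mul_left
  have hIψB : Integrable (fun x => ψ t x ^ 2 * B x) :=
    ((hψ.continuous.pow 2).mul hBcont).integrable_of_hasCompactSupport hBc.mul_left
  have hIfd : Integrable (fun x => ‖fderiv ℝ (fun y => ψ t y * ‖u y‖ ^ 2) x‖) :=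
    ((hf.continuous_fderiv one_ne_zero).integrable_of_hasCompactSupport
      (hfc.fderiv (𝕜 := ℝ))).norm
  set N := √(∫ x, ‖u x‖ ^ 2)
  have hN0 : 0 ≤ N := Real.sqrt_nonneg _
  have hN2 : N ^ 2 = ∫ x, ‖u x‖ ^ 2 := Real.sq_sqrt (by positivity)
  have hholder : ∫ x, ‖u x‖ * (ψ t x * ‖u x‖ ^ 2) ≤
      N * √(∫ x, (ψ t x * ‖u x‖ ^ 2) ^ 2) :=
    integral_mul_le_sqrt_mul_sqrt (fun x => norm_nonneg _)
      (fun x => mul_nonneg (ψ_nonneg ht x) (sq_nonneg _))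
      (hu1.continuous.norm.memLp_of_hasCompactSupport hc.norm)
      (hf.continuous.memLp_of_hasCompactSupport hfc)
  have hpt (x : ℝ²) : N * K * ‖fderiv ℝ (fun y => ψ t y * ‖u y‖ ^ 2) x‖ ≤
      δ * (ψ t x ^ 2 * ‖u x‖ ^ 2) + δ * (ψ t x ^ 2 * B x) + 1 / (4 * δ) * B x +
        ((N * K) ^ 2 + (N * K) ^ 4) / (2 * δ) * ‖u x‖ ^ 2 := by
    have h := weighted_young_le hδ (ψ_nonneg ht x) (N * K) ‖u x‖ √(B x)
    rw [Real.sq_sqrt (hB0 x)] at h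
    exact (mul_le_mul_of_nonneg_left (norm_fderiv_ψ_mul_norm_sq_le ht
      (hu1.differentiable one_ne_zero x)) (by positivity)).trans h
  have hint : N * K * ∫ x, ‖fderiv ℝ (fun y => ψ t y * ‖u y‖ ^ 2) x‖ ≤
      δ * (∫ x, ψ t x ^ 2 * ‖u x‖ ^ 2) + δ * (∫ x, ψ t x ^ 2 * B x) +
        1 / (4 * δ) * (∫ x, B x) +
        ((N * K) ^ 2 + (N * K) ^ 4) / (2 * δ) * (∫ x, ‖u x‖ ^ 2) := by
    have h12 := (hIψa.const_mul δ).add (hIψB.const_mul δ)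
    have h123 := h12.add (hIB.const_mul (1 / (4 * δ)))
    have h4 := hIa.const_mul (((N * K) ^ 2 + (N * K) ^ 4) / (2 * δ))
    have h := integral_mono (hIfd.const_mul (N * K)) (h123.add h4) hpt
    rw [integral_const_mul, integral_add' h123 h4, integral_add' h12 (hIB.const_mul _),
      integral_add' (hIψa.const_mul δ) (hIψB.const_mul δ)] at h
    simpa only [integral_const_mul] using h
  have hmain := (abs_integral_ψ_sq_convection_le ht hu1 hc hdiv).trans <| hholder.trans <|
    (mul_le_mul_of_nonneg_left (hGNS _ hf hfc) hN0).trans <|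
      (mul_assoc N K _).symm.trans_le hint
  refine hmain.trans ?_
  have hS : 0 ≤ ∫ x, B x := integral_nonneg hB0
  rw [← hN2]
  have hpow : ((N * K) ^ 2 + (N * K) ^ 4) / (2 * δ) * N ^ 2 ≤
      (K ^ 2 + K ^ 4) / (2 * δ) * (1 + (N ^ 2) ^ 3) := by
    rw [div_mul_eq_mul_div, div_mul_eq_mul_div]
    have h4 : N ^ 4 ≤ 1 + N ^ 6 := by
      nlinarith [sq_nonneg (N ^ 2 - 1), sq_nonneg N,
        mul_nonneg (sq_nonneg N) (sq_nonneg (N ^ 2 - 1))]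
    have h2 := mul_le_mul_of_nonneg_left h4 (sq_nonneg K)
    rw [div_le_div_iff_of_pos_right (by positivity)]
    have h6 : 0 ≤ K ^ 4 := by positivity
    linear_combination h2 + h6
  have hc1 : 0 ≤ (K ^ 2 + K ^ 4) / (2 * δ) * ∫ x, B x := by positivity
  have hc2 : 0 ≤ 1 / (4 * δ) * (1 + (N ^ 2) ^ 3) := by positivity
  linarith
end
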